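/- arXiv:1806.11071 — 7 statements merged into one kernel-verified Lean document; each statement's English description precedes it below -/
import Mathlib

section
/- Let N ≥ 1, let m : Fin N → ℕ with m j ≥ 2 for all j, and let a : (Π j : Fin N, Fin (m j)) → ℂ be a multipartite tensor. Then a is a product tensor (i.e., there exist b : Π j, (Fin (m j) → ℂ) with a i = ∏ j, b j (i j) for all i) if and only if for every k : Fin N and every pair of multi-indices i, i' one has a i * a i' = a (Function.update i k (i' k)) * a (Function.update i' k (i k)). (All 2×2 minors of all mode-k matricizations vanish.) -/
section MinorsOfTensors

variable {ι K : Type*} [DecidableEq ι] {α : ι → Type*}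

/-- The mode-`k` minors of a product tensor vanish. -/
theorem prod_mul_prod_eq_prod_update_mul_prod_update [Fintype ι] [CommMonoid K]
    (b : ∀ j, α j → K) (k : ι) (i i' : ∀ j, α j) :
    (∏ j, b j (i j)) * ∏ j, b j (i' j) =
      (∏ j, b j (Function.update i k (i' k) j)) * ∏ j, b j (Function.update i' k (i k) j) := by
  rw [← Finset.prod_mul_distrib, ← Finset.prod_mul_distrib]
  refine Finset.prod_congr rfl fun j _ => ?_
  rcases eq_or_ne j k with rfl | hj
  · simp [mul_comm]
  · simp [hj]

/-- If all minors vanish, the coordinates in `S` can be moved to those of a pivot `c` one by one,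
each at the cost of a factor depending only on that coordinate. -/
theorem eq_apply_piecewise_mul_prod_of_minors_vanish [Field K] {a : (∀ j, α j) → K}
    (h : ∀ (k : ι) (i i' : ∀ j, α j),
      a i * a i' = a (Function.update i k (i' k)) * a (Function.update i' k (i k)))
    {c : ∀ j, α j} (hc : a c ≠ 0) (i : ∀ j, α j) (S : Finset ι) :
    a i = a (S.piecewise c i) * ∏ j ∈ S, a (Function.update c j (i j)) / a c := by
  induction S using Finset.induction_on with
  | empty => simp
  | insert k S hk ih =>
    have hmin := h k (S.piecewise c i) c
    rw [Finset.piecewise_eq_of_notMem S c i hk] at hmin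
    rw [Finset.prod_insert hk, Finset.piecewise_insert, ← mul_assoc, mul_div_assoc', ← hmin,
      mul_div_cancel_right₀ _ hc]
    exact ih

/-- A tensor all of whose minors vanish is a product tensor. -/
theorem exists_eq_prod_of_minors_vanish [Fintype ι] [Nonempty ι] [Field K] {a : (∀ j, α j) → K}
    (h : ∀ (k : ι) (i i' : ∀ j, α j),
      a i * a i' = a (Function.update i k (i' k)) * a (Function.update i' k (i k))) :
    ∃ b : ∀ j, α j → K, ∀ i, a i = ∏ j, b j (i j) := by
  by_cases hzero : ∀ i, a i = 0
  · exact ⟨fun _ _ => 0, fun i => by simp [hzero i]⟩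
  · obtain ⟨c, hc⟩ := not_forall.mp hzero
    obtain ⟨j₀⟩ := ‹Nonempty ι›
    refine ⟨fun j x => (if j = j₀ then a c else 1) * (a (Function.update c j x) / a c),
      fun i => ?_⟩
    rw [Finset.prod_mul_distrib, Finset.prod_ite_eq' Finset.univ j₀ fun _ => a c,
      if_pos (Finset.mem_univ j₀)]
    simpa using eq_apply_piecewise_mul_prod_of_minors_vanish h hc i Finset.univ

end MinorsOfTensors

/-- A multipartite tensor `a` is a product tensor if and only if all
`2 × 2` minors of all its mode-`k` matricizations vanish, i.e. iff for every `k` and all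
multi-indices `i, i'` one has
`a i * a i' = a (update i k (i' k)) * a (update i' k (i k))`. -/
theorem product_tensor_iff_all_minors_vanish
    (N : ℕ) (hN : 1 ≤ N) (m : Fin N → ℕ) (hm : ∀ j, 2 ≤ m j)
    (a : (∀ j : Fin N, Fin (m j)) → ℂ) :
    (∃ b : ∀ j : Fin N, Fin (m j) → ℂ, ∀ i, a i = ∏ j, b j (i j)) ↔
      ∀ (k : Fin N) (i i' : ∀ j : Fin N, Fin (m j)),
        a i * a i' =
          a (Function.update i k (i' k)) * a (Function.update i' k (i k)) := by
  constructor
  · rintro ⟨b, hb⟩ k i i'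
    simp only [hb]
    exact prod_mul_prod_eq_prod_update_mul_prod_update b k i i'
  · intro h
    have : Nonempty (Fin N) := ⟨⟨0, hN⟩⟩
    exact exists_eq_prod_of_minors_vanish h
end

section
/- Let N ≥ 1, let m : Fin N → ℕ with m j ≥ 2 for all j, and let a : (Π j : Fin N, Fin (m j)) → ℂ. Then a is a product tensor if and only if for every pair of multi-indices i, i' and every subset T ⊆ Fin N one has a i * a i' = a (i mixed with i' on T) * a (i' mixed with i on T), where (i mixed with i' on T) is the multi-index whose j-th component is i' j if j ∈ T and i j otherwise, and (i' mixed with i on T) is the complementary mixed multi-index (i j if j ∈ T, i' j otherwise). -/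
/-- A product function satisfies all mixing equalities. -/
theorem prod_mul_prod_eq_prod_ite_mul_prod_ite {ι R : Type*} [Fintype ι] [DecidableEq ι]
    [CommMonoid R] {α : ι → Type*} (b : ∀ j, α j → R) (i i' : ∀ j, α j) (T : Finset ι) :
    (∏ j, b j (i j)) * ∏ j, b j (i' j) =
      (∏ j, b j (if j ∈ T then i' j else i j)) * ∏ j, b j (if j ∈ T then i j else i' j) := by
  rw [← Finset.prod_mul_distrib, ← Finset.prod_mul_distrib]
  refine Finset.prod_congr rfl fun j _ => ?_
  split_ifs
  · exact mul_comm _ _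
  · rfl

/-- If all single-coordinate mixing equalities hold and `a k ≠ 0`, then `a` at a multi-index
differing from `k` only on `S` is determined by the values of `a` at the multi-indices differing
from `k` in one position. -/
theorem eq_mul_prod_update_div_of_mixing {ι K : Type*} [DecidableEq ι] [Field K]
    {α : ι → Type*} (a : (∀ j, α j) → K)
    (h : ∀ (i i' : ∀ j, α j) (j₀ : ι), a i * a i' =
      a (Function.update i j₀ (i' j₀)) * a (Function.update i' j₀ (i j₀)))
    (k : ∀ j, α j) (hk : a k ≠ 0) (i : ∀ j, α j) (S : Finset ι) :
    a (S.piecewise i k) = a k * ∏ j ∈ S, a (Function.update k j (i j)) / a k := by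
  induction S using Finset.induction_on with
  | empty => simp
  | insert j S hj ih =>
    have key := h (S.piecewise i k) (Function.update k j (i j)) j
    rw [Function.update_self, Function.update_idem, Finset.piecewise_eq_of_notMem _ _ _ hj,
      Function.update_eq_self, ← Finset.piecewise_insert, ih] at key
    rw [Finset.prod_insert hj, ← mul_left_inj' hk, ← key]
    field_simp


/-- A multipartite tensor `a` is a product tensor if and only if for all
multi-indices `i, i'` and every subset `T` of the parties,
`a i * a i' = a (i mixed with i' on T) * a (i' mixed with i on T)`, where the first mixed
multi-index takes the value `i' j` for `j ∈ T` and `i j` otherwise, and conversely for the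
second. -/
theorem product_tensor_iff_all_mixing_equalities
    (N : ℕ) (hN : 1 ≤ N) (m : Fin N → ℕ) (hm : ∀ j, 2 ≤ m j)
    (a : (∀ j : Fin N, Fin (m j)) → ℂ) :
    (∃ b : ∀ j : Fin N, Fin (m j) → ℂ, ∀ i, a i = ∏ j, b j (i j)) ↔
      ∀ (i i' : ∀ j : Fin N, Fin (m j)) (T : Finset (Fin N)),
        a i * a i' =
          a (fun j => if j ∈ T then i' j else i j) *
            a (fun j => if j ∈ T then i j else i' j) := by
  constructor
  · rintro ⟨b, hb⟩ i i' T
    simp only [hb]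
    exact prod_mul_prod_eq_prod_ite_mul_prod_ite b i i' T
  · intro h
    let j₀ : Fin N := ⟨0, hN⟩
    by_cases ha : ∀ i, a i = 0
    · exact ⟨fun _ _ => 0, fun i => by
        rw [ha i, Finset.prod_eq_zero (Finset.mem_univ j₀) rfl]⟩
    push Not at ha
    obtain ⟨k, hk⟩ := ha
    refine ⟨fun j x => (if j = j₀ then a k else 1) * (a (Function.update k j x) / a k),
      fun i => ?_⟩
    have hupdate (i i' : ∀ j, Fin (m j)) (l : Fin N) : a i * a i' =
        a (Function.update i l (i' l)) * a (Function.update i' l (i l)) := by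
      convert h i i' {l} using 3 <;>
      · ext j
        by_cases hj : j = l
        · subst hj
          simp
        · simp [hj]
    have hprod := eq_mul_prod_update_div_of_mixing a hupdate k hk i Finset.univ
    rw [Finset.piecewise_univ] at hprod
    rw [hprod, Finset.prod_mul_distrib, Finset.prod_ite_eq' Finset.univ j₀ fun _ => a k,
      if_pos (Finset.mem_univ _)]
end

section
/- Let N ≥ 1, let m : Fin N → ℕ with m j ≥ 2 for all j, and let a : (Π j : Fin N, Fin (m j)) → ℂ. For each k : Fin N, define the mode-k matricization A⁽ᵏ⁾ as the matrix with row index Fin (m k) and column index Π (j : {j : Fin N // j ≠ k}), Fin (m j), whose entry at (x, y) is a evaluated at the multi-index with k-th component x and j-th component y j for j ≠ k. Then a is a product tensor if and only if for every k : Fin N the matrix A⁽ᵏ⁾ has rank at most 1. -/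
/-- The mode-`k` matricization of a multipartite tensor `a` : the matrix whose rows are
indexed by `Fin (m k)`, whose columns are indexed by the multi-indices on the remaining
parties, and whose `(x, y)` entry is `a` evaluated at the multi-index with `k`-th
component `x` and `j`-th component `y j` for `j ≠ k`. -/
def modeMatricization {N : ℕ} {m : Fin N → ℕ}
    (a : (∀ j : Fin N, Fin (m j)) → ℂ) (k : Fin N) :
    Matrix (Fin (m k)) (∀ j : {j : Fin N // j ≠ k}, Fin (m j.1)) ℂ :=
  Matrix.of fun x y =>
    a (fun j => if h : j = k then Fin.cast (congrArg m h.symm) x else y ⟨j, h⟩)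

/-- A matrix of rank at most one is an outer product of two vectors. -/
theorem Matrix.exists_eq_mul_of_rank_le_one {ι κ K : Type*} [Fintype ι] [Fintype κ] [Field K]
    {M : Matrix ι κ K} (h : M.rank ≤ 1) :
    ∃ (u : ι → K) (v : κ → K), ∀ x y, M x y = u x * v y := by
  rw [Matrix.rank_eq_finrank_span_cols, finrank_le_one_iff] at h
  obtain ⟨u, hu⟩ := h
  choose v hv using fun y => hu ⟨M.col y, Submodule.subset_span ⟨y, rfl⟩⟩
  refine ⟨u.1, v, fun x y => ?_⟩
  have := congrFun (congrArg Subtype.val (hv y)) x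
  simpa [mul_comm] using this.symm

theorem modeMatricization_apply_restrict {N : ℕ} {m : Fin N → ℕ}
    (a : (∀ j : Fin N, Fin (m j)) → ℂ) (k : Fin N) (i : ∀ j : Fin N, Fin (m j)) :
    modeMatricization a k (i k) (fun j => i j.1) = a i := by
  refine congrArg a (funext fun j => ?_)
  by_cases h : j = k
  · subst h
    simp
  · simp [h]

/-- Exchanging the `k`-th components of two multi-indices preserves the product of the
corresponding entries when the mode-`k` matricization has rank at most one. -/
theorem mul_eq_mul_update_of_rank_modeMatricization_le_one {N : ℕ} {m : Fin N → ℕ}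
    {a : (∀ j : Fin N, Fin (m j)) → ℂ} {k : Fin N} (h : (modeMatricization a k).rank ≤ 1)
    (i i' : ∀ j : Fin N, Fin (m j)) :
    a i * a i' = a (Function.update i k (i' k)) * a (Function.update i' k (i k)) := by
  obtain ⟨u, v, huv⟩ := Matrix.exists_eq_mul_of_rank_le_one h
  have key (l : ∀ j : Fin N, Fin (m j)) : a l = u (l k) * v (fun j => l j.1) := by
    rw [← modeMatricization_apply_restrict a k l, huv]
  have restrict (l : ∀ j : Fin N, Fin (m j)) (x : Fin (m k)) :
      (fun j : {j : Fin N // j ≠ k} => Function.update l k x j.1) =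
        fun j : {j : Fin N // j ≠ k} => l j.1 :=
    funext fun j => Function.update_of_ne j.2 _ _
  rw [key i, key i', key (Function.update i k _), key (Function.update i' k _), restrict,
    restrict, Function.update_self, Function.update_self]
  ring

/-- A product tensor has matricizations of rank at most one. -/
theorem rank_modeMatricization_le_one_of_eq_prod {N : ℕ} {m : Fin N → ℕ}
    {a : (∀ j : Fin N, Fin (m j)) → ℂ} {b : ∀ j : Fin N, Fin (m j) → ℂ}
    (h : ∀ i, a i = ∏ j, b j (i j)) (k : Fin N) : (modeMatricization a k).rank ≤ 1 := by
  have hM : modeMatricization a k =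
      Matrix.vecMulVec (b k) (fun y => ∏ j : {j : Fin N // j ≠ k}, b j.1 (y j)) := by
    ext x y
    simp only [modeMatricization, Matrix.of_apply, Matrix.vecMulVec_apply, h]
    rw [Fintype.prod_eq_mul_prod_subtype_ne _ k]
    congr 1
    · simp
    · exact Finset.prod_congr rfl fun j _ => by simp [j.2]
  rw [hM]
  exact Matrix.rank_vecMulVec_le _ _

/-- If all matricizations have rank at most one, the components of the multi-index in a set `s`
can be factored out relative to a base point `i₀` where the tensor does not vanish. -/
theorem eq_piecewise_mul_prod_of_rank_modeMatricization_le_one {N : ℕ} {m : Fin N → ℕ}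
    {a : (∀ j : Fin N, Fin (m j)) → ℂ} (h : ∀ k, (modeMatricization a k).rank ≤ 1)
    {i₀ : ∀ j : Fin N, Fin (m j)} (h₀ : a i₀ ≠ 0) (i : ∀ j : Fin N, Fin (m j))
    (s : Finset (Fin N)) :
    a i = a (s.piecewise i₀ i) * ∏ k ∈ s, a (Function.update i₀ k (i k)) / a i₀ := by
  induction s using Finset.induction_on with
  | empty => simp
  | insert k s hk ih =>
    have hswap := mul_eq_mul_update_of_rank_modeMatricization_le_one (h k) (s.piecewise i₀ i) i₀
    rw [Finset.piecewise_eq_of_notMem _ _ _ hk] at hswap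
    rw [Finset.prod_insert hk, Finset.piecewise_insert, ← mul_assoc, ← mul_div_assoc, ← hswap,
      mul_div_cancel_right₀ _ h₀]
    exact ih

/-- A multipartite tensor `a` is a product tensor if and only if every
mode-`k` matricization of `a` has rank at most `1`. -/
theorem product_tensor_iff_matricizations_rank_le_one
    (N : ℕ) (hN : 1 ≤ N) (m : Fin N → ℕ) (hm : ∀ j, 2 ≤ m j)
    (a : (∀ j : Fin N, Fin (m j)) → ℂ) :
    (∃ b : ∀ j : Fin N, Fin (m j) → ℂ, ∀ i, a i = ∏ j, b j (i j)) ↔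
      ∀ k : Fin N, (modeMatricization a k).rank ≤ 1 := by
  refine ⟨fun ⟨b, hb⟩ => rank_modeMatricization_le_one_of_eq_prod hb, fun h => ?_⟩
  let j₀ : Fin N := ⟨0, hN⟩
  by_cases hz : ∀ i, a i = 0
  · refine ⟨fun _ _ => 0, fun i => ?_⟩
    rw [hz i, Finset.prod_eq_zero (Finset.mem_univ j₀) rfl]
  · push Not at hz
    obtain ⟨i₀, h₀⟩ := hz
    refine ⟨fun j x => (if j = j₀ then a i₀ else 1) * (a (Function.update i₀ j x) / a i₀),
      fun i => ?_⟩
    rw [Finset.prod_mul_distrib, Finset.prod_ite_eq' Finset.univ j₀ fun _ => a i₀]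
    simpa using eq_piecewise_mul_prod_of_rank_modeMatricization_le_one h h₀ i Finset.univ
end

section
/- Let A : Matrix (Fin 2) (Fin 2) ℂ be symmetric (Aᵀ = A). Then there exists a unitary U ∈ U(2) such that U * A * Uᵀ is hollow (both diagonal entries are zero) if and only if the two singular values of A are equal. -/
open Matrix

/-- The singular values of a complex square matrix `A`: the nonnegative square roots of
the eigenvalues of the positive semidefinite Hermitian matrix `A * Aᴴ`. -/
noncomputable def singularValues {n : Type*} [Fintype n] [DecidableEq n]
    (A : Matrix n n ℂ) : n → ℝ :=
  fun i => Real.sqrt ((Matrix.isHermitian_mul_conjTranspose_self A).eigenvalues i)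

/-- A Hermitian matrix is the scalar matrix `r` if and only if all its eigenvalues equal `r`. -/
theorem Matrix.IsHermitian.eq_smul_one_iff_eigenvalues {n : Type*} [Fintype n] [DecidableEq n]
    {M : Matrix n n ℂ} (hM : M.IsHermitian) (r : ℝ) :
    M = (r : ℂ) • (1 : Matrix n n ℂ) ↔ ∀ i, hM.eigenvalues i = r := by
  constructor
  · intro h i
    have hi := hM.mulVec_eigenvectorBasis i
    have hne : (⇑(hM.eigenvectorBasis i) : n → ℂ) ≠ 0 := by
      intro h0
      apply hM.eigenvectorBasis.orthonormal.ne_zero i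
      ext j
      exact congrFun h0 j
    obtain ⟨j, hj⟩ := Function.ne_iff.mp hne
    have hij := congrFun (congrArg (· *ᵥ ⇑(hM.eigenvectorBasis i)) h) j
    simp only [hi] at hij
    simp only [smul_mulVec, one_mulVec, Pi.smul_apply, Complex.real_smul, smul_eq_mul] at hij
    exact_mod_cast mul_right_cancel₀ hj hij
  · intro h
    have hd : diagonal (RCLike.ofReal ∘ hM.eigenvalues) = (r : ℂ) • (1 : Matrix n n ℂ) := by
      rw [smul_one_eq_diagonal]
      congr 1
      funext i
      simp [h i]
    rw [hM.spectral_theorem, hd, map_smul, map_one]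

open scoped ComplexOrder in
/-- The two singular values of a `2 × 2` matrix are equal if and only if its Gram matrix
`A * Aᴴ` is scalar. -/
theorem singularValues_zero_eq_one_iff (A : Matrix (Fin 2) (Fin 2) ℂ) :
    singularValues A 0 = singularValues A 1 ↔
      ∃ r : ℝ, A * Aᴴ = (r : ℂ) • (1 : Matrix (Fin 2) (Fin 2) ℂ) := by
  have hnn := (Matrix.posSemidef_self_mul_conjTranspose A).eigenvalues_nonneg
  simp only [(isHermitian_mul_conjTranspose_self A).eq_smul_one_iff_eigenvalues,
    Fin.forall_fin_two, singularValues]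
  rw [Real.sqrt_inj (hnn 0) (hnn 1)]
  constructor
  · intro h
    exact ⟨_, h, rfl⟩
  · rintro ⟨r, h0, h1⟩
    rw [h0, h1]

/-- The Gram matrix `A * Aᴴ` is scalar if and only if that of a matrix unitarily congruent to `A`
is the same scalar. -/
theorem unitary_congr_mul_conjTranspose_eq_smul_one_iff {n : Type*} [Fintype n] [DecidableEq n]
    {U : Matrix n n ℂ} (hU : U ∈ unitaryGroup n ℂ) (A : Matrix n n ℂ) (r : ℂ) :
    (U * A * Uᵀ) * (U * A * Uᵀ)ᴴ = r • (1 : Matrix n n ℂ) ↔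
      A * Aᴴ = r • (1 : Matrix n n ℂ) := by
  have h1 : U * Uᴴ = 1 := mem_unitaryGroup_iff.mp hU
  have h2 : Uᴴ * U = 1 := mem_unitaryGroup_iff'.mp hU
  have h3 : Uᵀ * Uᵀᴴ = 1 := by
    have h : Uᵀᴴ = Uᴴᵀ := rfl
    rw [h, ← transpose_mul, h2, transpose_one]
  have key : (U * A * Uᵀ) * (U * A * Uᵀ)ᴴ = U * (A * Aᴴ) * Uᴴ := by
    simp only [conjTranspose_mul]
    calc U * A * Uᵀ * (Uᵀᴴ * (Aᴴ * Uᴴ)) = U * A * (Uᵀ * Uᵀᴴ) * (Aᴴ * Uᴴ) := by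
          simp only [Matrix.mul_assoc]
      _ = _ := by simp only [h3, Matrix.mul_one, Matrix.mul_assoc]
  rw [key]
  constructor
  · intro h
    calc A * Aᴴ = (Uᴴ * U) * (A * Aᴴ) * (Uᴴ * U) := by rw [h2, Matrix.one_mul, Matrix.mul_one]
      _ = Uᴴ * (U * (A * Aᴴ) * Uᴴ) * U := by simp only [Matrix.mul_assoc]
      _ = r • 1 := by rw [h, Matrix.mul_smul, Matrix.mul_one, Matrix.smul_mul, h2]
  · intro h
    rw [h, Matrix.mul_smul, Matrix.mul_one, Matrix.smul_mul, h1]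

/-- A binary complex quadratic form has a nonzero isotropic vector. -/
theorem exists_ne_zero_binary_quadratic_eq_zero (a b c : ℂ) :
    ∃ x y : ℂ, (x ≠ 0 ∨ y ≠ 0) ∧ a * x ^ 2 + 2 * b * (x * y) + c * y ^ 2 = 0 := by
  by_cases ha : a = 0
  · exact ⟨1, 0, Or.inl one_ne_zero, by simp [ha]⟩
  · obtain ⟨d, hd⟩ := IsAlgClosed.exists_pow_nat_eq (b ^ 2 - a * c) two_pos
    exact ⟨d - b, a, Or.inr ha, by linear_combination a * hd⟩

/-- Every nonzero vector of `ℂ²` is proportional to the first row of a unitary matrix. -/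
theorem exists_unitary_row_eq_smul {x y : ℂ} (h : x ≠ 0 ∨ y ≠ 0) :
    ∃ U ∈ unitaryGroup (Fin 2) ℂ, ∃ t : ℂ, U 0 = ![t * x, t * y] := by
  have hpos : 0 < Complex.normSq x + Complex.normSq y := by
    rcases h with h | h
    · exact add_pos_of_pos_of_nonneg (Complex.normSq_pos.mpr h) (Complex.normSq_nonneg y)
    · exact add_pos_of_nonneg_of_pos (Complex.normSq_nonneg x) (Complex.normSq_pos.mpr h)
  set t : ℝ := (√(Complex.normSq x + Complex.normSq y))⁻¹ with ht
  have htt : t ^ 2 * (Complex.normSq x + Complex.normSq y) = 1 := by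
    rw [ht, inv_pow, Real.sq_sqrt hpos.le, inv_mul_cancel₀ hpos.ne']
  have hc : (t : ℂ) ^ 2 * (x * star x + y * star y) = 1 := by
    simp only [Complex.star_def, Complex.mul_conj]
    exact_mod_cast htt
  refine ⟨!![t * x, t * y; -(t * star y), t * star x], ?_, t, rfl⟩
  rw [mem_unitaryGroup_iff]
  ext i j
  fin_cases i <;> fin_cases j <;>
    simp [Matrix.mul_apply, Fin.sum_univ_two, star_eq_conjTranspose] <;>
    simp only [Complex.star_def] at hc
  · linear_combination hc
  · ring
  · ring
  · linear_combination hc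

/-- A symmetric `2 × 2` complex matrix is hollow once its first diagonal entry vanishes and its
Gram matrix is scalar. -/
theorem apply_one_one_eq_zero_of_mul_conjTranspose_eq_smul_one {B : Matrix (Fin 2) (Fin 2) ℂ}
    (hB : Bᵀ = B) (h0 : B 0 0 = 0) {r : ℂ}
    (h : B * Bᴴ = r • (1 : Matrix (Fin 2) (Fin 2) ℂ)) : B 1 1 = 0 := by
  have hs : B 1 0 = B 0 1 := congrFun (congrFun hB 0) 1
  have e0 := congrFun (congrFun h 0) 0
  have e1 := congrFun (congrFun h 1) 1
  simp only [Matrix.mul_apply, Fin.sum_univ_two, conjTranspose_apply, h0, hs,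
    Matrix.smul_apply, Matrix.one_apply_eq, zero_mul, zero_add] at e0 e1
  rw [← e0, add_eq_left] at e1
  simpa using e1

/-- A symmetric `2 × 2` complex matrix is hollowisable by unitary
congruence (some unitary `U` makes `U * A * Uᵀ` have zero diagonal) if and only if its
two singular values are equal. -/
theorem symm_two_by_two_hollowisable_iff_singular_values_eq
    (A : Matrix (Fin 2) (Fin 2) ℂ) (hA : Aᵀ = A) :
    (∃ U ∈ Matrix.unitaryGroup (Fin 2) ℂ, ∀ i, (U * A * Uᵀ) i i = 0) ↔
      singularValues A 0 = singularValues A 1 := by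
  have hsym (U : Matrix (Fin 2) (Fin 2) ℂ) : (U * A * Uᵀ)ᵀ = U * A * Uᵀ := by
    simp only [transpose_mul, transpose_transpose, hA, Matrix.mul_assoc]
  rw [singularValues_zero_eq_one_iff]
  constructor
  · rintro ⟨U, hU, h⟩
    refine ⟨Complex.normSq ((U * A * Uᵀ) 0 1), ?_⟩
    rw [← unitary_congr_mul_conjTranspose_eq_smul_one_iff hU]
    have hs : (U * A * Uᵀ) 1 0 = (U * A * Uᵀ) 0 1 := congrFun (congrFun (hsym U) 0) 1
    generalize U * A * Uᵀ = B at h hs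
    ext i j
    fin_cases i <;> fin_cases j <;>
      simp [Matrix.mul_apply, Fin.sum_univ_two, h, hs, Complex.mul_conj]
  · rintro ⟨r, h⟩
    obtain ⟨x, y, hxy, hq⟩ := exists_ne_zero_binary_quadratic_eq_zero (A 0 0) (A 0 1) (A 1 1)
    obtain ⟨U, hU, t, hrow⟩ := exists_unitary_row_eq_smul hxy
    have hs : A 1 0 = A 0 1 := congrFun (congrFun hA 0) 1
    have h0 : (U * A * Uᵀ) 0 0 = 0 := by
      simp only [Matrix.mul_apply, Fin.sum_univ_two, transpose_apply, hrow, hs,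
        Matrix.cons_val_zero, Matrix.cons_val_one]
      linear_combination t ^ 2 * hq
    exact ⟨U, hU, Fin.forall_fin_two.mpr ⟨h0,
      apply_one_one_eq_zero_of_mul_conjTranspose_eq_smul_one (hsym U) h0
        ((unitary_congr_mul_conjTranspose_eq_smul_one_iff hU A r).mpr h)⟩⟩
end

section
/- Let (A_α)_{α ∈ F} be a family of symmetric 2 × 2 complex matrices (A_αᵀ = A_α). Then there exists a single unitary U ∈ U(2) such that U * A_α * Uᵀ is hollow for every α if and only if (i) for every α the two singular values of A_α are equal, and (ii) every two members of the family are linearly dependent over ℂ (i.e., for all α, β there exist c, c' ∈ ℂ not both zero with c • A_α = c' • A_β). -/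
open Matrix

/-- All singular values of `A` equal `√r` when `A * Aᴴ` is the scalar matrix `r`. -/
lemma singularValues_eq_of_mul_conjTranspose_eq_smul_one {n : Type*} [Fintype n] [DecidableEq n]
    {A : Matrix n n ℂ} {r : ℂ} (h : A * Aᴴ = r • 1) (i : n) :
    singularValues A i = Real.sqrt r.re := by
  have hH := Matrix.isHermitian_mul_conjTranspose_self A
  have hv := hH.mulVec_eigenvectorBasis i
  have hne : (hH.eigenvectorBasis i) ≠ 0 := hH.eigenvectorBasis.orthonormal.ne_zero i
  obtain ⟨j, hj⟩ : ∃ j, hH.eigenvectorBasis i j ≠ 0 := by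
    by_contra! hz
    exact hne (by ext j; simpa using hz j)
  have hmv : ∀ v, (A * Aᴴ) *ᵥ v = r • v := fun v => by
    rw [h, Matrix.smul_mulVec, Matrix.one_mulVec]
  rw [hmv] at hv
  have hvj := congrFun hv j
  have hr : r = (hH.eigenvalues i : ℂ) := by
    simp only [Pi.smul_apply, smul_eq_mul, Complex.real_smul] at hvj
    exact mul_right_cancel₀ hj hvj
  rw [singularValues, hr, Complex.ofReal_re]

open scoped ComplexOrder in
/-- If all singular values of `A` coincide, then `A * Aᴴ` is a scalar matrix. -/
lemma exists_mul_conjTranspose_eq_smul_one_of_singularValues {n : Type*} [Fintype n]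
    [DecidableEq n] {A : Matrix n n ℂ} (i₀ : n)
    (h : ∀ i, singularValues A i = singularValues A i₀) :
    ∃ r : ℂ, A * Aᴴ = r • 1 := by
  have hH := Matrix.isHermitian_mul_conjTranspose_self A
  have hpos : ∀ i, 0 ≤ hH.eigenvalues i :=
    (Matrix.posSemidef_self_mul_conjTranspose A).eigenvalues_nonneg
  have heq : ∀ i, hH.eigenvalues i = hH.eigenvalues i₀ := fun i =>
    (Real.sqrt_inj (hpos i) (hpos i₀)).1 (h i)
  refine ⟨(hH.eigenvalues i₀ : ℂ), ?_⟩
  have hd : Matrix.diagonal (RCLike.ofReal ∘ hH.eigenvalues : n → ℂ)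
      = (hH.eigenvalues i₀ : ℂ) • (1 : Matrix n n ℂ) := by
    ext i j
    by_cases hij : i = j
    · subst hij
      simp [heq i]
    · simp [hij]
  have hs := hH.spectral_theorem
  rw [hd, map_smul, map_one] at hs
  exact hs

/-- The row vector `(z, 1)` and its orthogonal complement `(-1, conj z)`, normalised, form a
unitary matrix. -/
lemma exists_unitary_smul_of_two_by_two (z : ℂ) :
    ∃ s : ℂ, s • !![z, 1; -1, star z] ∈ Matrix.unitaryGroup (Fin 2) ℂ := by
  have hpos : 0 < 1 + Complex.normSq z := by have := Complex.normSq_nonneg z; positivity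
  refine ⟨((Real.sqrt (1 + Complex.normSq z))⁻¹ : ℝ), ?_⟩
  set s : ℝ := (Real.sqrt (1 + Complex.normSq z))⁻¹ with hs
  have hss : (s : ℂ) * s * (1 + z * star z) = 1 := by
    have h1 : s * s * (1 + Complex.normSq z) = 1 := by
      rw [hs, ← mul_inv, Real.mul_self_sqrt hpos.le, inv_mul_cancel₀ hpos.ne']
    have h2 : z * star z = (Complex.normSq z : ℂ) := Complex.mul_conj z
    rw [h2]
    exact_mod_cast h1
  rw [Matrix.mem_unitaryGroup_iff, Matrix.star_eq_conjTranspose]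
  ext i j
  fin_cases i <;> fin_cases j <;>
    simp [Matrix.mul_apply, Fin.sum_univ_two, Matrix.conjTranspose_apply] <;>
    simp only [← starRingEnd_apply] at hss ⊢ <;>
    first | linear_combination hss | ring1

/-- A symmetric `2 × 2` matrix with equal singular values is hollowisable. -/
lemma exists_unitary_hollow_of_mul_conjTranspose_eq_smul_one {A : Matrix (Fin 2) (Fin 2) ℂ}
    (hA : Aᵀ = A) {r : ℂ} (h : A * Aᴴ = r • 1) :
    ∃ U ∈ Matrix.unitaryGroup (Fin 2) ℂ, ∀ i, (U * A * Uᵀ) i i = 0 := by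
  have hsym : A 1 0 = A 0 1 := congrFun (congrFun hA 0) 1
  have h00 := congrFun (congrFun h 0) 0
  have h11 := congrFun (congrFun h 1) 1
  have h01 := congrFun (congrFun h 0) 1
  simp only [Matrix.mul_apply, Fin.sum_univ_two, Matrix.conjTranspose_apply, hsym,
    Matrix.smul_apply, Matrix.one_apply_eq, smul_eq_mul, mul_one] at h00 h11 h01
  rw [Matrix.one_apply_ne (by decide), mul_zero] at h01
  have hnorm : A 0 0 * star (A 0 0) = A 1 1 * star (A 1 1) := by
    linear_combination h00 - h11
  by_cases ha : A 0 0 = 0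
  · have hd : A 1 1 = 0 := by
      rw [ha, zero_mul] at hnorm
      simpa using hnorm.symm
    refine ⟨1, one_mem _, fun i => ?_⟩
    fin_cases i <;> simp [ha, hd]
  obtain ⟨w, hw⟩ := IsAlgClosed.exists_pow_nat_eq (A 0 1 ^ 2 - A 0 0 * A 1 1) two_pos
  obtain ⟨z, hz⟩ : ∃ z, A 0 0 * z = -A 0 1 + w :=
    ⟨(-A 0 1 + w) / A 0 0, mul_div_cancel₀ _ ha⟩
  have hroot : A 0 0 * z ^ 2 + 2 * A 0 1 * z + A 1 1 = 0 := by
    apply mul_left_cancel₀ ha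
    linear_combination hw + (A 0 0 * z + A 0 1 + w) * hz
  have hroot' : A 0 0 - 2 * A 0 1 * star z + A 1 1 * star z ^ 2 = 0 := by
    have hc : star (A 0 0) - 2 * star (A 0 1) * z + star (A 1 1) * z ^ 2 = 0 := by
      apply mul_left_cancel₀ ha
      linear_combination hnorm - 2 * z * h01 + star (A 1 1) * hroot
    have := congrArg star hc
    simpa using this
  obtain ⟨s, hs⟩ := exists_unitary_smul_of_two_by_two z
  refine ⟨_, hs, fun i => ?_⟩
  fin_cases i
  · simp [Matrix.mul_apply, Matrix.vecMul, dotProduct, Fin.sum_univ_two, hsym]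
    linear_combination s ^ 2 * hroot
  · simp [Matrix.mul_apply, Matrix.vecMul, dotProduct, Fin.sum_univ_two, hsym]
    simp only [Complex.star_def] at hroot'
    linear_combination s ^ 2 * hroot'

/-- A symmetric `2 × 2` matrix made hollow by the unitary congruence with `U` is a multiple of
a fixed unitary matrix that depends only on `U`. -/
lemma eq_smul_of_unitary_hollow {A U : Matrix (Fin 2) (Fin 2) ℂ} (hA : Aᵀ = A)
    (hU : U ∈ Matrix.unitaryGroup (Fin 2) ℂ) (h : ∀ i, (U * A * Uᵀ) i i = 0) :
    A = (U * A * Uᵀ) 0 1 • (Uᴴ * !![0, 1; 1, 0] * Uᴴᵀ) := by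
  have hsym : (U * A * Uᵀ)ᵀ = U * A * Uᵀ := by
    simp [Matrix.transpose_mul, hA, Matrix.mul_assoc]
  have hX : U * A * Uᵀ = (U * A * Uᵀ) 0 1 • !![0, 1; 1, 0] := by
    have h10 : (U * A * Uᵀ) 1 0 = (U * A * Uᵀ) 0 1 := congrFun (congrFun hsym 0) 1
    have h0 := h 0
    have h1 := h 1
    generalize U * A * Uᵀ = B at *
    ext i j
    fin_cases i <;> fin_cases j <;> simp [h0, h1, h10]
  have hUU : Uᴴ * U = 1 := Matrix.mem_unitaryGroup_iff'.1 hU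
  have hUT : Uᵀ * Uᴴᵀ = 1 := by rw [← Matrix.transpose_mul, hUU, Matrix.transpose_one]
  calc A = (Uᴴ * U) * A * (Uᵀ * Uᴴᵀ) := by rw [hUU, hUT, one_mul, mul_one]
    _ = Uᴴ * (U * A * Uᵀ) * Uᴴᵀ := by simp only [Matrix.mul_assoc]
    _ = _ := by
      conv_lhs => rw [hX]
      rw [Matrix.mul_smul, Matrix.smul_mul]

/-- The unitary congruence of the exchange matrix is unitary. -/
lemma conjTranspose_congruence_exchange_mem_unitaryGroup {U : Matrix (Fin 2) (Fin 2) ℂ}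
    (hU : U ∈ Matrix.unitaryGroup (Fin 2) ℂ) :
    Uᴴ * !![0, 1; 1, 0] * Uᴴᵀ ∈ Matrix.unitaryGroup (Fin 2) ℂ := by
  have hUU : Uᴴ * U = 1 := Matrix.mem_unitaryGroup_iff'.1 hU
  have hUU' : U * Uᴴ = 1 := Matrix.mem_unitaryGroup_iff.1 hU
  refine mul_mem (mul_mem ?_ ?_) ?_
  · exact Unitary.star_mem hU
  · rw [Matrix.mem_unitaryGroup_iff, Matrix.star_eq_conjTranspose]
    ext i j
    fin_cases i <;> fin_cases j <;> simp [Matrix.mul_apply, Fin.sum_univ_two]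
  · rw [Matrix.mem_unitaryGroup_iff, Matrix.star_eq_conjTranspose,
      show Uᴴᵀᴴ = Uᵀ by ext; simp, ← Matrix.transpose_mul, hUU', Matrix.transpose_one]

/-- A family of symmetric `2 × 2` complex matrices is simultaneously
hollowisable by unitary congruence (one unitary `U` makes every `U * A_α * Uᵀ` have zero
diagonal) if and only if (i) each member has its two singular values equal and (ii) every
two members are linearly dependent over `ℂ`. -/
theorem symm_two_by_two_simultaneously_hollowisable_iff
    {F : Type*} (A : F → Matrix (Fin 2) (Fin 2) ℂ) (hA : ∀ α, (A α)ᵀ = A α) :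
    (∃ U ∈ Matrix.unitaryGroup (Fin 2) ℂ, ∀ α, ∀ i, (U * A α * Uᵀ) i i = 0) ↔
      (∀ α, singularValues (A α) 0 = singularValues (A α) 1) ∧
        ∀ α β, ∃ c c' : ℂ, (c ≠ 0 ∨ c' ≠ 0) ∧ c • A α = c' • A β := by
  constructor
  · rintro ⟨U, hU, h⟩
    obtain ⟨V, hV, d, hd⟩ : ∃ V ∈ Matrix.unitaryGroup (Fin 2) ℂ,
        ∃ d : F → ℂ, ∀ α, A α = d α • V :=
      ⟨_, conjTranspose_congruence_exchange_mem_unitaryGroup hU, _,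
        fun α => eq_smul_of_unitary_hollow (hA α) hU (h α)⟩
    refine ⟨fun α => ?_, fun α β => ?_⟩
    · have hVV : V * Vᴴ = 1 := Matrix.mem_unitaryGroup_iff.1 hV
      have hscalar : A α * (A α)ᴴ = (d α * star (d α)) • 1 := by
        rw [hd α, Matrix.conjTranspose_smul, Matrix.smul_mul, Matrix.mul_smul, hVV, smul_smul]
      rw [singularValues_eq_of_mul_conjTranspose_eq_smul_one hscalar,
        singularValues_eq_of_mul_conjTranspose_eq_smul_one hscalar]
    · by_cases hz : d α = 0 ∧ d β = 0
      · exact ⟨1, 1, Or.inl one_ne_zero, by simp [hd, hz.1, hz.2]⟩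
      · refine ⟨d β, d α, by tauto, ?_⟩
        rw [hd α, hd β, smul_smul, smul_smul, mul_comm]
  · rintro ⟨hs, hdep⟩
    by_cases hzero : ∀ α, A α = 0
    · exact ⟨1, one_mem _, fun α i => by simp [hzero α]⟩
    push Not at hzero
    obtain ⟨α₀, hα₀⟩ := hzero
    obtain ⟨r, hr⟩ := exists_mul_conjTranspose_eq_smul_one_of_singularValues (A := A α₀) 1
      (by intro i; fin_cases i; exacts [hs α₀, rfl])
    obtain ⟨U, hU, h⟩ := exists_unitary_hollow_of_mul_conjTranspose_eq_smul_one (hA α₀) hr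
    refine ⟨U, hU, fun β i => ?_⟩
    obtain ⟨c, c', hc, hcc⟩ := hdep α₀ β
    have hc' : c' ≠ 0 := by
      rintro rfl
      rw [zero_smul, smul_eq_zero] at hcc
      tauto
    have hβ : A β = (c'⁻¹ * c) • A α₀ := by
      rw [mul_smul, hcc, inv_smul_smul₀ hc']
    rw [hβ, Matrix.mul_smul, Matrix.smul_mul, Matrix.smul_apply, h i, smul_zero]
end

section
/- Let n ≥ 2 and let (A_α)_{α ∈ F} be a family of symmetric n × n complex matrices each supported on the top-left 2 × 2 block (i.e., (A_α) i j = 0 whenever i ≥ 2 or j ≥ 2). Then there exists a single unitary U ∈ U(n) such that U * A_α * Uᵀ is hollow for every α if and only if (i) for every α the two largest singular values of A_α are equal, and (ii) every two members of the family are linearly dependent over ℂ. -/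
open Matrix

open ComplexConjugate

theorem Matrix.IsHermitian.trace_mul_self_eq_sum_eigenvalues_sq {ι : Type*} [Fintype ι]
    [DecidableEq ι] {M : Matrix ι ι ℂ} (hM : M.IsHermitian) :
    (M * M).trace = ∑ i, ((hM.eigenvalues i : ℂ)) ^ 2 := by
  conv_lhs => rw [hM.spectral_theorem, ← map_mul, Unitary.conjStarAlgAut_apply, trace_mul_comm,
    ← mul_assoc]
  simp [trace_diagonal, diagonal_mul_diagonal, sq]

section TopLeftBlock

variable {m : ℕ}

/-- The matrix vanishes outside of its top-left `2 × 2` block. -/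
def SupportedOnBlock (M : Matrix (Fin (m + 2)) (Fin (m + 2)) ℂ) : Prop :=
  ∀ i j : Fin (m + 2), 2 ≤ (i : ℕ) ∨ 2 ≤ (j : ℕ) → M i j = 0

namespace SupportedOnBlock

variable {M A : Matrix (Fin (m + 2)) (Fin (m + 2)) ℂ}

theorem row_eq_zero (hM : SupportedOnBlock M) (k : Fin m) (j : Fin (m + 2)) :
    M k.succ.succ j = 0 :=
  hM _ _ (Or.inl (by simp))

theorem col_eq_zero (hM : SupportedOnBlock M) (i : Fin (m + 2)) (k : Fin m) :
    M i k.succ.succ = 0 :=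
  hM _ _ (Or.inr (by simp))

theorem ext_block (hM : SupportedOnBlock M) (hA : SupportedOnBlock A) (h00 : M 0 0 = A 0 0)
    (h01 : M 0 1 = A 0 1) (h10 : M 1 0 = A 1 0) (h11 : M 1 1 = A 1 1) : M = A := by
  ext i j
  refine Fin.cases ?_ (Fin.cases ?_ fun k => ?_) i
  · refine Fin.cases h00 (Fin.cases h01 fun l => ?_) j
    rw [hM.col_eq_zero, hA.col_eq_zero]
  · refine Fin.cases h10 (Fin.cases h11 fun l => ?_) j
    rw [hM.col_eq_zero, hA.col_eq_zero]
  · rw [hM.row_eq_zero, hA.row_eq_zero]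

theorem smul (hM : SupportedOnBlock M) (c : ℂ) : SupportedOnBlock (c • M) := fun i j h => by
  simp [hM i j h]

theorem trace_eq (hM : SupportedOnBlock M) : M.trace = M 0 0 + M 1 1 := by
  simp [trace, Fin.sum_univ_succ, hM.row_eq_zero]

theorem trace_mul_self_eq (hM : SupportedOnBlock M) :
    (M * M).trace = M 0 0 ^ 2 + 2 * (M 0 1 * M 1 0) + M 1 1 ^ 2 := by
  simp [trace, Matrix.mul_apply, Fin.sum_univ_succ, hM.row_eq_zero, hM.col_eq_zero]
  ring

theorem mul_conjTranspose_self (hA : SupportedOnBlock A) : SupportedOnBlock (A * Aᴴ) := by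
  rintro i j (h | h)
  · simp [Matrix.mul_apply, fun k => hA i k (Or.inl h)]
  · simp [Matrix.mul_apply, fun k => hA j k (Or.inl h)]

theorem mul_conjTranspose_self_apply (hA : SupportedOnBlock A) (i j : Fin (m + 2)) :
    (A * Aᴴ) i j = A i 0 * conj (A j 0) + A i 1 * conj (A j 1) := by
  simp [Matrix.mul_apply, Fin.sum_univ_succ, hA.col_eq_zero]

theorem rank_le_two (hA : SupportedOnBlock A) : A.rank ≤ 2 := by
  have h : A = A.submatrix id ![0, 1] *
      (1 : Matrix (Fin (m + 2)) (Fin (m + 2)) ℂ).submatrix ![0, 1] id := by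
    ext i j
    simp only [Matrix.mul_apply, Fin.sum_univ_two, submatrix_apply, Matrix.one_apply]
    refine Fin.cases ?_ (Fin.cases ?_ fun k => ?_) j
    · simp
    · simp
    · simp [hA.col_eq_zero, Fin.ext_iff]
  rw [h]
  exact (rank_mul_le_left _ _).trans (rank_le_width _)

theorem mul_mul_transpose_apply_self (hA : SupportedOnBlock A) (hsymm : Aᵀ = A)
    (U : Matrix (Fin (m + 2)) (Fin (m + 2)) ℂ) (i : Fin (m + 2)) :
    (U * A * Uᵀ) i i =
      A 0 0 * U i 0 ^ 2 + 2 * A 0 1 * (U i 0 * U i 1) + A 1 1 * U i 1 ^ 2 := by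
  have h : A 1 0 = A 0 1 := congrFun (congrFun hsymm 0) 1
  simp [Matrix.mul_apply, Fin.sum_univ_succ, hA.row_eq_zero, hA.col_eq_zero, h]
  ring

/-- The two largest singular values coincide exactly when the positive semidefinite matrix
`A * Aᴴ` of rank at most two satisfies the equality case of `(tr M)² ≤ 2 tr M²`. -/
theorem sorted_singularValues_eq_iff_trace (hA : SupportedOnBlock A) {s : Fin (m + 2) → ℝ}
    (hs : Antitone s) {σ : Equiv.Perm (Fin (m + 2))} (hσ : singularValues A = s ∘ σ) :
    s 0 = s 1 ↔ 2 * (A * Aᴴ * (A * Aᴴ)).trace = (A * Aᴴ).trace ^ 2 := by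
  have hM := isHermitian_mul_conjTranspose_self A
  have hsq (i) : hM.eigenvalues i = s (σ i) ^ 2 := by
    have h : √(hM.eigenvalues i) = s (σ i) := congrFun hσ i
    rw [← h, Real.sq_sqrt (Matrix.eigenvalues_self_mul_conjTranspose_nonneg A i)]
  have hnonneg (i) : 0 ≤ s i := by
    have h : √(hM.eigenvalues (σ.symm i)) = s (σ (σ.symm i)) := congrFun hσ _
    rw [Equiv.apply_symm_apply] at h
    exact h ▸ Real.sqrt_nonneg _
  have hcard : Fintype.card {i // s i ≠ 0} ≤ 2 := by
    calc Fintype.card {i // s i ≠ 0} = Fintype.card {i // hM.eigenvalues i ≠ 0} :=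
          (Fintype.card_congr (σ.subtypeEquiv fun i => by simp [hsq])).symm
      _ = (A * Aᴴ).rank := hM.rank_eq_card_non_zero_eigs.symm
      _ ≤ 2 := (rank_mul_le_left _ _).trans hA.rank_le_two
  have hzero (k : Fin m) : s k.succ.succ = 0 := by
    by_contra hk
    have hpos : 0 < s k.succ.succ := lt_of_le_of_ne (hnonneg _) (Ne.symm hk)
    have hsub : Finset.Iic k.succ.succ ⊆ Finset.univ.filter (s · ≠ 0) := fun i hi => by
      simpa using (hpos.trans_le (hs (Finset.mem_Iic.1 hi))).ne'
    have hle : (Finset.Iic k.succ.succ).card ≤ 2 :=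
      (Finset.card_le_card hsub).trans (by rw [← Fintype.card_subtype]; convert hcard)
    rw [Fin.card_Iic, Fin.val_succ, Fin.val_succ] at hle
    omega
  have htr : (A * Aᴴ).trace = ((s 0 ^ 2 + s 1 ^ 2 : ℝ) : ℂ) := by
    rw [hM.trace_eq_sum_eigenvalues]
    simp only [hsq]
    rw [Equiv.sum_comp σ fun i => (RCLike.ofReal (s i ^ 2) : ℂ)]
    simp [Fin.sum_univ_succ, hzero]
  have htr2 : (A * Aᴴ * (A * Aᴴ)).trace = ((s 0 ^ 4 + s 1 ^ 4 : ℝ) : ℂ) := by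
    rw [hM.trace_mul_self_eq_sum_eigenvalues_sq]
    simp only [hsq]
    rw [Equiv.sum_comp σ fun i => ((s i ^ 2 : ℝ) : ℂ) ^ 2]
    simp [Fin.sum_univ_succ, hzero]
    ring
  rw [htr, htr2]
  norm_cast
  constructor
  · intro h
    rw [h]
    ring
  · intro h
    have h' : (s 0 ^ 2 - s 1 ^ 2) ^ 2 = 0 := by linear_combination h
    exact (sq_eq_sq₀ (hnonneg _) (hnonneg _)).1 (sub_eq_zero.1 (pow_eq_zero_iff two_ne_zero |>.1 h'))

theorem two_mul_trace_eq_iff (hA : SupportedOnBlock A) (hsymm : Aᵀ = A) :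
    2 * (A * Aᴴ * (A * Aᴴ)).trace = (A * Aᴴ).trace ^ 2 ↔
      A 0 0 * conj (A 0 0) = A 1 1 * conj (A 1 1) ∧
        A 0 0 * conj (A 0 1) + A 0 1 * conj (A 1 1) = 0 := by
  have h : A 1 0 = A 0 1 := congrFun (congrFun hsymm 0) 1
  rw [hA.mul_conjTranspose_self.trace_mul_self_eq, hA.mul_conjTranspose_self.trace_eq]
  simp only [hA.mul_conjTranspose_self_apply, h]
  generalize A 0 0 = a, A 0 1 = b, A 1 1 = c
  have hconj : b * conj a + c * conj b = conj (a * conj b + b * conj c) := by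
    simp; ring
  rw [hconj]
  constructor
  · intro H
    have H' : (((Complex.normSq a - Complex.normSq c) ^ 2 +
        4 * Complex.normSq (a * conj b + b * conj c) : ℝ) : ℂ) = 0 := by
      push_cast
      simp only [← Complex.mul_conj]
      linear_combination H
    have H'' := Complex.ofReal_eq_zero.1 H'
    have h1 := Complex.normSq_nonneg (a * conj b + b * conj c)
    have h2 := sq_nonneg (Complex.normSq a - Complex.normSq c)
    refine ⟨?_, Complex.normSq_eq_zero.1 (by linarith)⟩
    rw [Complex.mul_conj, Complex.mul_conj]
    exact congrArg _ (sub_eq_zero.1 (pow_eq_zero_iff two_ne_zero |>.1 (by linarith)))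
  · rintro ⟨h1, h2⟩
    rw [h2, h1]
    simp only [map_zero, mul_zero, add_zero]
    ring

/-- The two largest singular values of a symmetric matrix `A` supported on the top-left block
coincide exactly when that block of `A * Aᴴ` is scalar. -/
theorem sorted_singularValues_eq_iff (hA : SupportedOnBlock A) (hsymm : Aᵀ = A) :
    (∀ s : Fin (m + 2) → ℝ, Antitone s →
      (∃ σ : Equiv.Perm (Fin (m + 2)), singularValues A = s ∘ σ) → s 0 = s 1) ↔
      A 0 0 * conj (A 0 0) = A 1 1 * conj (A 1 1) ∧
        A 0 0 * conj (A 0 1) + A 0 1 * conj (A 1 1) = 0 := by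
  rw [← hA.two_mul_trace_eq_iff hsymm]
  constructor
  · intro h
    let τ := Tuple.sort (-singularValues A)
    have hs : Antitone (singularValues A ∘ τ) := fun i j hij =>
      neg_le_neg_iff.1 (Tuple.monotone_sort (-singularValues A) hij)
    have hσ : singularValues A = (singularValues A ∘ τ) ∘ τ.symm := by
      ext i
      simp
    exact (hA.sorted_singularValues_eq_iff_trace hs hσ).1 (h _ hs ⟨_, hσ⟩)
  · rintro h s hs ⟨σ, hσ⟩
    exact (hA.sorted_singularValues_eq_iff_trace hs hσ).2 h

end SupportedOnBlock

/-- The first two columns `x`, `y` of a unitary matrix satisfy `∑ |p y - q x|² = |p|² + |q|²`, in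
polarised form. -/
theorem sum_det_mul_conj_det {U : Matrix (Fin (m + 2)) (Fin (m + 2)) ℂ}
    (hU : U ∈ unitaryGroup (Fin (m + 2)) ℂ) (p₁ p₂ q₁ q₂ : ℂ) :
    ∑ k, (p₁ * U k 1 - p₂ * U k 0) * conj (q₁ * U k 1 - q₂ * U k 0) =
      p₁ * conj q₁ + p₂ * conj q₂ := by
  have hcol (i j) : ∑ k, U k i * conj (U k j) = if j = i then 1 else 0 := by
    rw [← Matrix.one_apply, ← mem_unitaryGroup_iff'.1 hU, Matrix.mul_apply]
    exact Finset.sum_congr rfl fun k _ => by simp [Matrix.star_apply, mul_comm]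
  calc _ = p₁ * conj q₁ * ∑ k, U k 1 * conj (U k 1) - p₁ * conj q₂ * ∑ k, U k 1 * conj (U k 0)
        - p₂ * conj q₁ * ∑ k, U k 0 * conj (U k 1)
        + p₂ * conj q₂ * ∑ k, U k 0 * conj (U k 0) := by
        simp only [Finset.mul_sum, ← Finset.sum_sub_distrib, ← Finset.sum_add_distrib]
        refine Finset.sum_congr rfl fun k _ => ?_
        simp only [map_sub, map_mul]
        ring
    _ = _ := by simp [hcol]

theorem exists_rows_det_ne_zero {U : Matrix (Fin (m + 2)) (Fin (m + 2)) ℂ}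
    (hU : U ∈ unitaryGroup (Fin (m + 2)) ℂ) :
    ∃ i j, U i 0 * U j 1 - U i 1 * U j 0 ≠ 0 := by
  by_contra! h
  have hrow (i) : U i 0 = 0 := by
    have := sum_det_mul_conj_det hU (U i 0) (U i 1) 1 0
    simpa [h] using this.symm
  have := sum_det_mul_conj_det hU 0 1 0 1
  simp [hrow] at this

/-- A binary quadratic form vanishing on two independent vectors is a multiple of the product of
the two corresponding linear forms. -/
theorem quadratic_form_eq_mul {a b c p₁ p₂ q₁ q₂ : ℂ} (hdet : p₁ * q₂ - p₂ * q₁ ≠ 0)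
    (hp : a * p₁ ^ 2 + 2 * b * (p₁ * p₂) + c * p₂ ^ 2 = 0)
    (hq : a * q₁ ^ 2 + 2 * b * (q₁ * q₂) + c * q₂ ^ 2 = 0) :
    ∃ κ, a = κ * (2 * p₂ * q₂) ∧ b = κ * -(p₁ * q₂ + p₂ * q₁) ∧ c = κ * (2 * p₁ * q₁) := by
  refine ⟨-(a * p₁ * q₁ + b * (p₁ * q₂ + p₂ * q₁) + c * p₂ * q₂) / (p₁ * q₂ - p₂ * q₁) ^ 2,
    ?_, ?_, ?_⟩
  · rw [div_mul_eq_mul_div, eq_div_iff (pow_ne_zero 2 hdet)]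
    linear_combination q₂ ^ 2 * hp + p₂ ^ 2 * hq
  · rw [div_mul_eq_mul_div, eq_div_iff (pow_ne_zero 2 hdet)]
    linear_combination -q₁ * q₂ * hp - p₁ * p₂ * hq
  · rw [div_mul_eq_mul_div, eq_div_iff (pow_ne_zero 2 hdet)]
    linear_combination q₁ ^ 2 * hp + p₁ ^ 2 * hq

theorem exists_ne_zero_quadratic_form_eq_zero (a b c : ℂ) :
    ∃ p₁ p₂ : ℂ, (p₁ ≠ 0 ∨ p₂ ≠ 0) ∧ a * p₁ ^ 2 + 2 * b * (p₁ * p₂) + c * p₂ ^ 2 = 0 := by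
  by_cases ha : a = 0
  · exact ⟨1, 0, by simp, by simp [ha]⟩
  · obtain ⟨r, hr⟩ := IsAlgClosed.exists_eq_mul_self (discrim a (2 * b) c)
    obtain ⟨x, hx⟩ := exists_quadratic_eq_zero ha ⟨r, hr⟩
    exact ⟨x, 1, by simp, by linear_combination hx⟩

theorem exists_unit_quadratic_form_eq_zero (a b c : ℂ) :
    ∃ p₁ p₂ : ℂ, p₁ * conj p₁ + p₂ * conj p₂ = 1 ∧
      a * p₁ ^ 2 + 2 * b * (p₁ * p₂) + c * p₂ ^ 2 = 0 := by
  obtain ⟨p₁, p₂, h0, h⟩ := exists_ne_zero_quadratic_form_eq_zero a b c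
  have hpos : 0 < Complex.normSq p₁ + Complex.normSq p₂ := by
    have h1 := Complex.normSq_nonneg p₁
    have h2 := Complex.normSq_nonneg p₂
    rcases h0 with h0 | h0
    · linarith [Complex.normSq_pos.2 h0]
    · linarith [Complex.normSq_pos.2 h0]
  set r := √(Complex.normSq p₁ + Complex.normSq p₂) with hr
  have hr0 : (r : ℂ) ≠ 0 := by exact_mod_cast (Real.sqrt_pos.2 hpos).ne'
  have hr2 : (r : ℂ) ^ 2 = p₁ * conj p₁ + p₂ * conj p₂ := by
    rw [Complex.mul_conj, Complex.mul_conj]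
    exact_mod_cast Real.sq_sqrt hpos.le
  refine ⟨p₁ / r, p₂ / r, ?_, ?_⟩
  · simp only [map_div₀, Complex.conj_ofReal]
    field_simp
    linear_combination -hr2
  · field_simp
    linear_combination h

/-- The unitary matrix with first two rows `(p₁, p₂)` and `(-conj p₂, conj p₁)`, extended by the
identity. -/
noncomputable def blockRotation (m : ℕ) (p₁ p₂ : ℂ) : Matrix (Fin (m + 2)) (Fin (m + 2)) ℂ :=
  Matrix.of (Fin.cons (Fin.cons p₁ (Fin.cons p₂ 0))
    (Fin.cons (Fin.cons (-conj p₂) (Fin.cons (conj p₁) 0))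
      fun k => Fin.cons 0 (Fin.cons 0 (Pi.single k 1))))

theorem blockRotation_mem_unitaryGroup {p₁ p₂ : ℂ} (h : p₁ * conj p₁ + p₂ * conj p₂ = 1) :
    blockRotation m p₁ p₂ ∈ unitaryGroup (Fin (m + 2)) ℂ := by
  rw [mem_unitaryGroup_iff]
  ext i j
  rw [Matrix.mul_apply, Fin.sum_univ_succ, Fin.sum_univ_succ]
  refine Fin.cases ?_ (Fin.cases ?_ fun k => ?_) i <;>
    refine Fin.cases ?_ (Fin.cases ?_ fun l => ?_) j
  all_goals simp [blockRotation, Matrix.star_apply, Matrix.one_apply]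
  · exact h
  · ring
  · exact (Fin.succ_ne_zero _).symm
  · ring
  · linear_combination h
  · simp [Fin.ext_iff]
  · simp [Fin.ext_iff]
  · simp [Pi.single_apply, eq_comm]

theorem exists_unitary_hollow_of_singularValues_eq
    {A : Matrix (Fin (m + 2)) (Fin (m + 2)) ℂ} (hA : SupportedOnBlock A) (hsymm : Aᵀ = A)
    (h1 : A 0 0 * conj (A 0 0) = A 1 1 * conj (A 1 1))
    (h2 : A 0 0 * conj (A 0 1) + A 0 1 * conj (A 1 1) = 0) :
    ∃ U ∈ unitaryGroup (Fin (m + 2)) ℂ, ∀ i, (U * A * Uᵀ) i i = 0 := by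
  obtain ⟨p₁, p₂, hp, hq⟩ := exists_unit_quadratic_form_eq_zero (A 0 0) (A 0 1) (A 1 1)
  refine ⟨blockRotation m p₁ p₂, blockRotation_mem_unitaryGroup hp, fun i => ?_⟩
  rw [hA.mul_mul_transpose_apply_self hsymm]
  revert h1 h2 hq
  generalize A 0 0 = a, A 0 1 = b, A 1 1 = c
  intro h1 h2 hq
  refine Fin.cases ?_ (Fin.cases ?_ fun k => ?_) i
  · exact hq
  · change a * (-conj p₂) ^ 2 + 2 * b * (-conj p₂ * conj p₁) + c * conj p₁ ^ 2 = 0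
    have hq' := congrArg conj hq
    simp only [map_add, map_mul, map_pow, map_zero, Complex.conj_ofNat] at hq'
    by_cases hc : c = 0
    · subst hc
      have ha : a = 0 := by simpa using h1
      subst ha
      have hb : b * conj b * (p₁ * p₂) = 0 := by linear_combination conj b * hq / 2
      have : b * (conj p₁ * conj p₂) = 0 := by simpa using hb
      linear_combination -2 * this
    · refine (mul_eq_zero.1 (?_ : conj c * _ = 0)).resolve_left (by simpa using hc)
      linear_combination a * hq' - conj p₁ ^ 2 * h1 - 2 * conj p₁ * conj p₂ * h2
  · change a * 0 ^ 2 + 2 * b * (0 * 0) + c * 0 ^ 2 = 0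
    ring

variable {F : Type*} {A : F → Matrix (Fin (m + 2)) (Fin (m + 2)) ℂ}

/-- If a family is simultaneously hollowised, then its members are multiples of one symmetric
matrix, given by the product of two linear forms, which are orthogonal when some member is
nonzero. -/
theorem exists_rows_of_hollow (hA : ∀ α, (A α)ᵀ = A α) (hsupp : ∀ α, SupportedOnBlock (A α))
    {U : Matrix (Fin (m + 2)) (Fin (m + 2)) ℂ} (hU : U ∈ unitaryGroup (Fin (m + 2)) ℂ)
    (hollow : ∀ α, ∀ i, (U * A α * Uᵀ) i i = 0) :
    ∃ p₁ p₂ q₁ q₂ : ℂ, ∀ α, ∃ κ, A α 0 0 = κ * (2 * p₂ * q₂) ∧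
      A α 0 1 = κ * -(p₁ * q₂ + p₂ * q₁) ∧ A α 1 1 = κ * (2 * p₁ * q₁) ∧
      (κ ≠ 0 → p₁ * conj q₁ + p₂ * conj q₂ = 0) := by
  obtain ⟨i, j, hij⟩ := exists_rows_det_ne_zero hU
  have hform (α k) := (hsupp α).mul_mul_transpose_apply_self (hA α) U k ▸ hollow α k
  refine ⟨U i 0, U i 1, U j 0, U j 1, fun α => ?_⟩
  obtain ⟨κ, ha, hb, hc⟩ := quadratic_form_eq_mul hij (hform α i) (hform α j)
  refine ⟨κ, ha, hb, hc, fun hκ => ?_⟩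
  rw [← sum_det_mul_conj_det hU]
  refine Finset.sum_eq_zero fun k _ => ?_
  have hk := hform α k
  rw [ha, hb, hc] at hk
  have : κ * 2 * ((U i 0 * U k 1 - U i 1 * U k 0) * (U j 0 * U k 1 - U j 1 * U k 0)) = 0 := by
    linear_combination hk
  rcases mul_eq_zero.1 ((mul_eq_zero.1 this).resolve_left (by simpa using hκ)) with h | h
  · rw [h, zero_mul]
  · rw [h, map_zero, mul_zero]

theorem simultaneously_hollowisable_iff (hA : ∀ α, (A α)ᵀ = A α)
    (hsupp : ∀ α, SupportedOnBlock (A α)) :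
    (∃ U ∈ unitaryGroup (Fin (m + 2)) ℂ, ∀ α, ∀ i, (U * A α * Uᵀ) i i = 0) ↔
      (∀ α, A α 0 0 * conj (A α 0 0) = A α 1 1 * conj (A α 1 1) ∧
        A α 0 0 * conj (A α 0 1) + A α 0 1 * conj (A α 1 1) = 0) ∧
        ∀ α β, ∃ c c' : ℂ, (c ≠ 0 ∨ c' ≠ 0) ∧ c • A α = c' • A β := by
  have hlower (α) : A α 1 0 = A α 0 1 := congrFun (congrFun (hA α) 0) 1
  constructor
  · rintro ⟨U, hU, hollow⟩
    obtain ⟨p₁, p₂, q₁, q₂, h⟩ := exists_rows_of_hollow hA hsupp hU hollow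
    refine ⟨fun α => ?_, fun α β => ?_⟩
    · obtain ⟨κ, ha, hb, hc, horth⟩ := h α
      rw [ha, hb, hc]
      by_cases hκ : κ = 0
      · simp [hκ]
      have h0 := horth hκ
      have h0' := congrArg conj h0
      simp only [map_add, map_mul, map_zero, Complex.conj_conj] at h0'
      simp only [map_add, map_mul, map_neg, Complex.conj_ofNat]
      constructor
      · linear_combination 4 * κ * conj κ * (p₂ * conj q₂ * h0' - conj p₁ * q₁ * h0)
      · linear_combination -2 * κ * conj κ * (p₂ * conj q₁ * h0' + conj p₁ * q₂ * h0)
    · obtain ⟨κ, ha, hb, hc, -⟩ := h α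
      obtain ⟨κ', ha', hb', hc', -⟩ := h β
      have key : κ' • A α = κ • A β := by
        refine ((hsupp α).smul _).ext_block ((hsupp β).smul _) ?_ ?_ ?_ ?_ <;>
          simp only [Matrix.smul_apply, smul_eq_mul, hlower, ha, hb, hc, ha', hb', hc'] <;> ring
      by_cases hκ : κ = 0 ∧ κ' = 0
      · have hzero (γ) (ha : A γ 0 0 = 0) (hb : A γ 0 1 = 0) (hc : A γ 1 1 = 0) : A γ = 0 :=
          (hsupp γ).ext_block (fun _ _ _ => rfl) ha hb ((hlower γ).trans hb) hc
        refine ⟨1, 1, by simp, ?_⟩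
        rw [hzero α (by simp [ha, hκ]) (by simp [hb, hκ]) (by simp [hc, hκ]),
          hzero β (by simp [ha', hκ]) (by simp [hb', hκ]) (by simp [hc', hκ])]
      · exact ⟨κ', κ, by tauto, key⟩
  · rintro ⟨hsv, hdep⟩
    by_cases hall : ∀ α, A α = 0
    · exact ⟨1, one_mem _, by simp [hall]⟩
    push Not at hall
    obtain ⟨α, hα⟩ := hall
    obtain ⟨U, hU, hollow⟩ :=
      exists_unitary_hollow_of_singularValues_eq (hsupp α) (hA α) (hsv α).1 (hsv α).2
    refine ⟨U, hU, fun β i => ?_⟩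
    obtain ⟨c, c', hc, h⟩ := hdep α β
    have hc' : c' ≠ 0 := by
      rintro rfl
      simp_all
    have hβ : A β = (c'⁻¹ * c) • A α := by
      rw [mul_smul, h, smul_smul, inv_mul_cancel₀ hc', one_smul]
    rw [hβ, Matrix.mul_smul, Matrix.smul_mul, Matrix.smul_apply, hollow, smul_zero]

end TopLeftBlock

/-- Let `n ≥ 2` and let `(A_α)` be a family of symmetric `n × n` complex
matrices supported on the top-left `2 × 2` block. Then the family is simultaneously
hollowisable by unitary congruence if and only if (i) for every `α` the two largest
singular values of `A_α` (the first two entries of any decreasing rearrangement of its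
singular values) are equal, and (ii) every two members are linearly dependent over `ℂ`. -/
theorem extended_two_by_two_simultaneously_hollowisable_iff
    {n : ℕ} (hn : 2 ≤ n) {F : Type*} (A : F → Matrix (Fin n) (Fin n) ℂ)
    (hA : ∀ α, (A α)ᵀ = A α)
    (hsupp : ∀ α, ∀ i j : Fin n, 2 ≤ (i : ℕ) ∨ 2 ≤ (j : ℕ) → A α i j = 0) :
    (∃ U ∈ Matrix.unitaryGroup (Fin n) ℂ, ∀ α, ∀ i, (U * A α * Uᵀ) i i = 0) ↔
      (∀ α, ∀ s : Fin n → ℝ, Antitone s →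
          (∃ σ : Equiv.Perm (Fin n), singularValues (A α) = s ∘ σ) →
            s ⟨0, by omega⟩ = s ⟨1, by omega⟩) ∧
        ∀ α β, ∃ c c' : ℂ, (c ≠ 0 ∨ c' ≠ 0) ∧ c • A α = c' • A β := by
  obtain ⟨m, rfl⟩ := Nat.exists_eq_add_of_le' hn
  rw [simultaneously_hollowisable_iff hA hsupp]
  exact and_congr_left' (forall_congr' fun α =>
    (SupportedOnBlock.sorted_singularValues_eq_iff (hsupp α) (hA α)).symm)
end

section
/- Let N ≥ 1, m : Fin N → ℕ with m j ≥ 2 for all j, set I = Π j : Fin N, Fin (m j), and let ρ : Matrix I I ℂ be positive semidefinite of rank r. Then ρ is separable (admits a decomposition into product tensors) if and only if there exist p : ℕ with r ≤ p ≤ r² and vectors v : Fin p → (I → ℂ) such that ρ = ∑_{k=1}^{p} vecMulVec (v k) (star (v k)) and every v k satisfies all 2×2 minor equalities: for all κ : Fin N and all i, i' ∈ I, (v k) i * (v k) i' = (v k) (Function.update i κ (i' κ)) * (v k) (Function.update i' κ (i κ)). In this case ρ = ∑_{k=1}^{p} vecMulVec (v k) (star (v k)) is itself a separable decomposition of ρ.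 -/
open Matrix ComplexOrder

/-- The `2 × 2` minor equalities of a tensor. -/
def MinorEqs {ι : Type*} [DecidableEq ι] {α : ι → Type*} (v : (∀ j, α j) → ℂ) : Prop :=
  ∀ (κ : ι) (i i' : ∀ j, α j),
    v i * v i' = v (Function.update i κ (i' κ)) * v (Function.update i' κ (i κ))

theorem MinorEqs.smul {ι : Type*} [DecidableEq ι] {α : ι → Type*} {v : (∀ j, α j) → ℂ}
    (hv : MinorEqs v) (c : ℂ) : MinorEqs (c • v) := by
  intro κ i i'
  simp only [Pi.smul_apply, smul_eq_mul]
  linear_combination c ^ 2 * hv κ i i'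

theorem minorEqs_prod {ι : Type*} [DecidableEq ι] [Fintype ι] {α : ι → Type*}
    (b : ∀ j, α j → ℂ) : MinorEqs fun i : ∀ j, α j => ∏ j, b j (i j) := by
  intro κ i i'
  simp only [← Finset.prod_mul_distrib]
  refine Finset.prod_congr rfl fun j _ => ?_
  rcases eq_or_ne j κ with rfl | h
  · simp [mul_comm]
  · simp [h]

theorem MinorEqs.apply_piecewise {ι : Type*} [DecidableEq ι] {α : ι → Type*}
    {v : (∀ j, α j) → ℂ} (hv : MinorEqs v) {i₀ : ∀ j, α j} (h₀ : v i₀ ≠ 0)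
    (i : ∀ j, α j) (s : Finset ι) :
    v (s.piecewise i i₀) = v i₀ * ∏ j ∈ s, v (Function.update i₀ j (i j)) / v i₀ := by
  induction s using Finset.induction_on with
  | empty => simp
  | insert κ s hκ ih =>
    have h := hv κ (Function.update (s.piecewise i i₀) κ (i κ)) i₀
    have hy : Function.update (s.piecewise i i₀) κ (i₀ κ) = s.piecewise i i₀ := by
      rw [Function.update_eq_self_iff, Finset.piecewise_eq_of_notMem _ _ _ hκ]
    rw [Function.update_idem, hy, Function.update_self, ih] at h
    rw [Finset.piecewise_insert, Finset.prod_insert hκ]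
    apply mul_right_cancel₀ h₀
    rw [h]
    field_simp

theorem MinorEqs.exists_eq_prod {ι : Type*} [DecidableEq ι] [Fintype ι] [Nonempty ι]
    {α : ι → Type*} {v : (∀ j, α j) → ℂ} (hv : MinorEqs v) :
    ∃ b : ∀ j, α j → ℂ, ∀ i, v i = ∏ j, b j (i j) := by
  by_cases h : ∃ i₀, v i₀ ≠ 0
  · obtain ⟨i₀, h₀⟩ := h
    let j₀ : ι := Classical.arbitrary ι
    refine ⟨fun j x => (if j = j₀ then v i₀ else 1) * (v (Function.update i₀ j x) / v i₀),
      fun i => ?_⟩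
    have := hv.apply_piecewise h₀ i Finset.univ
    rw [Finset.piecewise_univ] at this
    rw [this, Finset.prod_mul_distrib, Finset.prod_ite_eq' Finset.univ j₀]
    simp
  · push Not at h
    exact ⟨fun _ _ => 0, fun i => by simp [h i]⟩

theorem sum_vecMulVec_star_eq_mul_conjTranspose {n κ : Type*} [Fintype κ] (u : κ → n → ℂ) :
    ∑ k, vecMulVec (u k) (star (u k)) = (of u)ᵀ * (of u)ᵀᴴ := by
  ext i j
  simp [Matrix.sum_apply, vecMulVec_apply, Matrix.mul_apply]

theorem rank_sum_vecMulVec_star {n κ : Type*} [Fintype n] [Fintype κ] (u : κ → n → ℂ) :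
    (∑ k, vecMulVec (u k) (star (u k))).rank =
      Module.finrank ℂ (Submodule.span ℂ (Set.range u)) := by
  rw [sum_vecMulVec_star_eq_mul_conjTranspose, rank_self_mul_conjTranspose,
    rank_eq_finrank_span_cols]
  rfl

/-- More than `r ^ 2` rank one projections onto vectors of an `r`-dimensional space are linearly
dependent over `ℝ`. -/
theorem exists_real_relation_vecMulVec_star {n : Type*} [Fintype n] {p : ℕ} (u : Fin p → n → ℂ)
    (hp : Module.finrank ℂ (Submodule.span ℂ (Set.range u)) ^ 2 < p) :
    ∃ t : Fin p → ℝ, (∃ k, 0 < t k) ∧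
      ∑ k, (t k : ℂ) • vecMulVec (u k) (star (u k)) = 0 := by
  set r := Module.finrank ℂ (Submodule.span ℂ (Set.range u)) with hr
  let e := Module.finBasisOfFinrankEq ℂ (Submodule.span ℂ (Set.range u)) hr.symm
  let c (k : Fin p) : Fin r → ℂ := e.repr ⟨u k, Submodule.subset_span ⟨k, rfl⟩⟩
  let E : Matrix n (Fin r) ℂ := of fun i a => (e a : n → ℂ) i
  have hu (k : Fin p) : u k = E *ᵥ c k := by
    have h := congrArg Subtype.val (e.sum_repr ⟨u k, Submodule.subset_span ⟨k, rfl⟩⟩)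
    ext i
    have h' := congrFun h i
    simp only [Submodule.coe_sum, Submodule.coe_smul, Finset.sum_apply, Pi.smul_apply,
      smul_eq_mul] at h'
    rw [← h']
    simp only [mulVec, dotProduct, E, of_apply, c]
    exact Finset.sum_congr rfl fun a _ => mul_comm _ _
  have hdep : ¬ LinearIndependent ℂ fun k => vecMulVec (c k) (star (c k)) := fun h => by
    have := h.fintype_card_le_finrank
    rw [Module.finrank_matrix] at this
    simp at this
    nlinarith
  obtain ⟨g, hg, k, hk⟩ := Fintype.not_linearIndependent_iff.mp hdep
  have hmap (k : Fin p) : vecMulVec (u k) (star (u k)) =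
      E * vecMulVec (c k) (star (c k)) * Eᴴ := by
    rw [hu, mul_vecMulVec, vecMulVec_mul, star_mulVec]
  have hgu : ∑ k, g k • vecMulVec (u k) (star (u k)) = 0 := by
    have h : ∑ k, g k • (E * vecMulVec (c k) (star (c k)) * Eᴴ) =
        E * (∑ k, g k • vecMulVec (c k) (star (c k))) * Eᴴ := by
      simp only [Matrix.mul_sum, Matrix.sum_mul, Matrix.mul_smul, Matrix.smul_mul]
    simp only [hmap, h, hg, Matrix.mul_zero, Matrix.zero_mul]
  have hgu' : ∑ k, star (g k) • vecMulVec (u k) (star (u k)) = 0 := by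
    have h := congrArg conjTranspose hgu
    simpa [conjTranspose_sum, conjTranspose_vecMulVec] using h
  have hex : ∃ s : Fin p → ℝ, (∃ k, s k ≠ 0) ∧
      ∑ k, (s k : ℂ) • vecMulVec (u k) (star (u k)) = 0 := by
    by_cases h : (g k).re = 0
    · refine ⟨fun k => (g k).im, ⟨k, fun h' => hk (Complex.ext h h')⟩, ?_⟩
      have him (k) : ((g k).im : ℂ) = (-Complex.I / 2) * g k + (Complex.I / 2) * star (g k) := by
        apply Complex.ext <;> simp <;> ring
      simp only [him, add_smul, mul_smul, Finset.sum_add_distrib, ← Finset.smul_sum, hgu, hgu']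
      simp
    · refine ⟨fun k => (g k).re, ⟨k, h⟩, ?_⟩
      have hre (k) : ((g k).re : ℂ) = (1 / 2 : ℂ) * g k + (1 / 2 : ℂ) * star (g k) := by
        apply Complex.ext <;> simp <;> ring
      simp only [hre, add_smul, mul_smul, Finset.sum_add_distrib, ← Finset.smul_sum, hgu, hgu']
      simp
  obtain ⟨s, ⟨k, hk⟩, hs⟩ := hex
  rcases lt_or_gt_of_ne hk with hlt | hgt
  · exact ⟨fun k => -s k, ⟨k, by simpa using hlt⟩, by simpa using hs⟩
  · exact ⟨s, ⟨k, hgt⟩, hs⟩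

theorem vecMulVec_sqrt_smul_star {n : Type*} {a : ℝ} (ha : 0 ≤ a) (u : n → ℂ) :
    vecMulVec ((√a : ℂ) • u) (star ((√a : ℂ) • u)) = (a : ℂ) • vecMulVec u (star u) := by
  have h : (√a : ℂ) * √a = a := by exact_mod_cast Real.mul_self_sqrt ha
  ext i j
  simp only [vecMulVec_apply, Pi.star_apply, Pi.smul_apply, Matrix.smul_apply, smul_eq_mul,
    star_mul', Complex.star_def, Complex.conj_ofReal]
  linear_combination (u i * (starRingEnd ℂ) (u j)) * h

theorem exists_shorter_sum_vecMulVec_star {n : Type*} [Fintype n] {S : (n → ℂ) → Prop}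
    (hS : ∀ (c : ℂ) v, S v → S (c • v)) {p : ℕ} (u : Fin (p + 1) → n → ℂ) (hu : ∀ k, S (u k))
    (hp : (∑ k, vecMulVec (u k) (star (u k))).rank ^ 2 < p + 1) :
    ∃ v : Fin p → n → ℂ, (∀ k, S (v k)) ∧
      ∑ k, vecMulVec (v k) (star (v k)) = ∑ k, vecMulVec (u k) (star (u k)) := by
  rw [rank_sum_vecMulVec_star] at hp
  obtain ⟨t, ⟨k, hk⟩, ht⟩ := exists_real_relation_vecMulVec_star u hp
  obtain ⟨k₀, hk₀⟩ := Finite.exists_max t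
  have hpos : 0 < t k₀ := hk.trans_le (hk₀ k)
  have hnonneg (k) : 0 ≤ 1 - t k / t k₀ := sub_nonneg.mpr ((div_le_one hpos).mpr (hk₀ k))
  refine ⟨fun j => (√(1 - t (k₀.succAbove j) / t k₀) : ℂ) • u (k₀.succAbove j),
    fun j => hS _ _ (hu _), ?_⟩
  have hsum : ∑ k, vecMulVec (u k) (star (u k)) =
      ∑ k, ((1 - t k / t k₀ : ℝ) : ℂ) • vecMulVec (u k) (star (u k)) := by
    have hcoef (k) : ((1 - t k / t k₀ : ℝ) : ℂ) = 1 - (t k₀ : ℂ)⁻¹ * t k := by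
      push_cast
      ring
    simp only [hcoef, sub_smul, one_smul, mul_smul, Finset.sum_sub_distrib, ← Finset.smul_sum, ht,
      smul_zero, sub_zero]
  rw [hsum, Fin.sum_univ_succAbove _ k₀, div_self hpos.ne', sub_self, Complex.ofReal_zero,
    zero_smul, zero_add]
  exact Finset.sum_congr rfl fun j _ => vecMulVec_sqrt_smul_star (hnonneg _) _

/-- Carathéodory bound for decompositions into rank one projections along a cone `S`. -/
theorem exists_sum_vecMulVec_star_le_rank_sq {n : Type*} [Fintype n] {S : (n → ℂ) → Prop}
    (hS : ∀ (c : ℂ) v, S v → S (c • v)) {ρ : Matrix n n ℂ} {p : ℕ} (u : Fin p → n → ℂ)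
    (hu : ∀ k, S (u k)) (hρ : ρ = ∑ k, vecMulVec (u k) (star (u k))) :
    ∃ q ≤ ρ.rank ^ 2, ∃ v : Fin q → n → ℂ, (∀ k, S (v k)) ∧
      ρ = ∑ k, vecMulVec (v k) (star (v k)) := by
  induction p with
  | zero => exact ⟨0, Nat.zero_le _, u, hu, hρ⟩
  | succ p ih =>
    by_cases hp : p + 1 ≤ ρ.rank ^ 2
    · exact ⟨p + 1, hp, u, hu, hρ⟩
    · obtain ⟨v, hv, hvu⟩ := exists_shorter_sum_vecMulVec_star hS u hu
        (by rw [← hρ]; exact not_le.mp hp)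
      exact ih v hv (hρ.trans hvu.symm)

theorem rank_sum_vecMulVec_star_le {n : Type*} [Fintype n] {p : ℕ} (u : Fin p → n → ℂ) :
    (∑ k, vecMulVec (u k) (star (u k))).rank ≤ p := by
  rw [rank_sum_vecMulVec_star]
  simpa [Set.finrank] using finrank_range_le_card (R := ℂ) u

/-- A positive semidefinite `ρ` of rank `r` on a multipartite system is
separable (decomposes into product tensors) if and only if there exist `p` with
`r ≤ p ≤ r²` and a decomposition `ρ = ∑_{k < p} |ṽ_k⟩⟨ṽ_k|` such that each vector `v k`
satisfies all `2 × 2` minor equalities (equivalently, all its generalized concurrences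
vanish); in this case the decomposition `ρ = ∑ k, vecMulVec (v k) (star (v k))` is itself
a separable decomposition of `ρ`. -/
theorem separable_iff_common_decomposition_with_vanishing_minors
    (N : ℕ) (hN : 1 ≤ N) (m : Fin N → ℕ) (hm : ∀ j, 2 ≤ m j)
    (ρ : Matrix (∀ j : Fin N, Fin (m j)) (∀ j : Fin N, Fin (m j)) ℂ)
    (hρ : ρ.PosSemidef) (r : ℕ) (hr : ρ.rank = r) :
    (∃ p : ℕ, ∃ u : Fin p → (∀ j : Fin N, Fin (m j)) → ℂ,
        (∀ k, ∃ b : ∀ j : Fin N, Fin (m j) → ℂ, ∀ i, u k i = ∏ j, b j (i j)) ∧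
          ρ = ∑ k, Matrix.vecMulVec (u k) (star (u k))) ↔
      ∃ p : ℕ, r ≤ p ∧ p ≤ r ^ 2 ∧
        ∃ v : Fin p → (∀ j : Fin N, Fin (m j)) → ℂ,
          ρ = ∑ k, Matrix.vecMulVec (v k) (star (v k)) ∧
            ∀ (k : Fin p) (κ : Fin N) (i i' : ∀ j : Fin N, Fin (m j)),
              v k i * v k i' =
                v k (Function.update i κ (i' κ)) * v k (Function.update i' κ (i κ)) := by
  constructor
  · rintro ⟨p, u, hu, hsum⟩
    have hmin (k) : MinorEqs (u k) := by
      obtain ⟨b, hb⟩ := hu k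
      exact funext hb ▸ minorEqs_prod b
    obtain ⟨q, hq, v, hv, hρv⟩ :=
      exists_sum_vecMulVec_star_le_rank_sq (S := MinorEqs) (fun c _ h => h.smul c) u hmin hsum
    refine ⟨q, ?_, hr ▸ hq, v, hρv, hv⟩
    rw [← hr, hρv]
    exact rank_sum_vecMulVec_star_le v
  · rintro ⟨p, -, -, v, hsum, hv⟩
    have : Nonempty (Fin N) := ⟨⟨0, hN⟩⟩
    exact ⟨p, v, fun k => MinorEqs.exists_eq_prod (hv k), hsum⟩
end
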